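/- Let A be an n×n sign pattern of cycle form such that a_{ii} ∈ {-, 0} for all i, every directed 2-cycle of D(A) is negative, D(A_+) contains a directed cycle of length n, D(A_-) does not contain a directed cycle of length n, and sign(a_{ij} a_{ji}) = − for some i ≠ j. If A is not SNS and A requires algebraic positivity, then for all i ≠ j with a_{ij} = + and a_{ji} = 0 one has a_{ii} = − and a_{jj} = −. -/

import Mathlib

open Matrix

/-- A real square matrix is algebraically positive if some real polynomial
evaluated at it has all entries positive. -/
def AlgPositive {n : ℕ} (M : Matrix (Fin n) (Fin n) ℝ) : Prop :=
  ∃ f : Polynomial ℝ, ∀ i j, 0 < Polynomial.aeval M f i j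

/-- `B` belongs to the qualitative class of the sign pattern `A`. -/
def InQClass {n : ℕ} (A : Matrix (Fin n) (Fin n) SignType)
    (B : Matrix (Fin n) (Fin n) ℝ) : Prop :=
  ∀ i j, SignType.sign (B i j) = A i j

/-- The sign pattern `A` requires algebraic positivity. -/
def RequiresAP {n : ℕ} (A : Matrix (Fin n) (Fin n) SignType) : Prop :=
  ∀ B : Matrix (Fin n) (Fin n) ℝ, InQClass A B → AlgPositive B

/-- An `n × n` sign pattern (indices read modulo `n`) is of cycle form if off-diagonal
entries away from the cycle `(0, 1, …, n-1, 0)` vanish and every edge of the cycle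
carries at least one nonzero arc. -/
def CycleForm {n : ℕ} [NeZero n] (A : Matrix (Fin n) (Fin n) SignType) : Prop :=
  (∀ i j : Fin n, i ≠ j → j ≠ i + 1 → i ≠ j + 1 → A i j = 0) ∧
  (∀ i : Fin n, A i (i + 1) ≠ 0 ∨ A (i + 1) i ≠ 0)

/-- For a cycle-form pattern, `D(A_+)` contains a directed cycle of length `n`. -/
def PlusNCycle {n : ℕ} [NeZero n] (A : Matrix (Fin n) (Fin n) SignType) : Prop :=
  (∀ i : Fin n, A i (i + 1) = 1) ∨ (∀ i : Fin n, A (i + 1) i = 1)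

/-- For a cycle-form pattern, `D(A_-)` contains a directed cycle of length `n`. -/
def MinusNCycle {n : ℕ} [NeZero n] (A : Matrix (Fin n) (Fin n) SignType) : Prop :=
  (∀ i : Fin n, A i (i + 1) = -1) ∨ (∀ i : Fin n, A (i + 1) i = -1)
/-- A sign pattern is sign non-singular if every matrix in its qualitative class
has nonzero determinant. -/
def IsSNS {n : ℕ} (A : Matrix (Fin n) (Fin n) SignType) : Prop :=
  ∀ B : Matrix (Fin n) (Fin n) ℝ, InQClass A B → B.det ≠ 0

namespace Matrix

section Perron

variable {ι : Type*} [Fintype ι] {M : Matrix ι ι ℝ}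

theorem mulVec_apply_pos_of_pos (hM : ∀ i j, 0 < M i j) {x : ι → ℝ} (hx : 0 ≤ x) (hx0 : x ≠ 0)
    (i : ι) : 0 < (M *ᵥ x) i := by
  obtain ⟨k, hk⟩ := Function.ne_iff.mp hx0
  exact Finset.sum_pos' (fun j _ => mul_nonneg (hM i j).le (hx j))
    ⟨k, Finset.mem_univ k, mul_pos (hM i k) (lt_of_le_of_ne (hx k) (Ne.symm hk))⟩

/-- Perron's theorem: an entrywise positive matrix has a positive eigenvector. -/
theorem exists_pos_eigenvector_of_pos [Nonempty ι] (hM : ∀ i j, 0 < M i j) :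
    ∃ (r : ℝ) (x : ι → ℝ), (∀ i, 0 < x i) ∧ M *ᵥ x = r • x := by
  classical
  have hne : ∀ x ∈ stdSimplex ℝ ι, x ≠ 0 := by
    rintro x hx rfl
    simpa using hx.2
  have hpos : ∀ x ∈ stdSimplex ℝ ι, ∀ i, 0 < (M *ᵥ x) i := fun x hx =>
    mulVec_apply_pos_of_pos hM hx.1 (hne x hx)
  let φ : (ι → ℝ) → ℝ := fun x =>
    Finset.univ.inf' Finset.univ_nonempty fun i => (M *ᵥ (M *ᵥ x)) i / (M *ᵥ x) i
  have hφ : ContinuousOn φ (stdSimplex ℝ ι) := by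
    refine ContinuousOn.finset_inf'_apply _ fun i _ => ContinuousOn.div ?_ ?_ ?_
    · exact Continuous.continuousOn (by fun_prop)
    · exact Continuous.continuousOn (by fun_prop)
    · exact fun x hx => (hpos x hx i).ne'
  obtain ⟨x, hx, hmax⟩ := (isCompact_stdSimplex ℝ ι).exists_isMaxOn
    ⟨_, single_mem_stdSimplex ℝ (Classical.arbitrary ι)⟩ hφ
  have hy := hpos x hx
  set y := M *ᵥ x with hydef
  refine ⟨φ x, y, hy, ?_⟩
  have hle : 0 ≤ M *ᵥ y - φ x • y := fun i => by
    have : φ x ≤ (M *ᵥ y) i / y i := Finset.inf'_le _ (Finset.mem_univ i)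
    simpa using (le_div_iff₀ (hy i)).mp this
  by_contra hcon
  have hstrict := mulVec_apply_pos_of_pos hM hle (sub_ne_zero.mpr hcon)
  have hs : 0 < ∑ i, y i := Finset.sum_pos (fun i _ => hy i) Finset.univ_nonempty
  have hmem : (∑ i, y i)⁻¹ • y ∈ stdSimplex ℝ ι := by
    refine ⟨fun i => mul_nonneg (inv_pos.mpr hs).le (hy i).le, ?_⟩
    simp [← Finset.mul_sum, hs.ne']
  have hlt : φ x < φ ((∑ i, y i)⁻¹ • y) := by
    refine (Finset.lt_inf'_iff _).mpr fun i _ => ?_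
    rw [lt_div_iff₀ (hpos _ hmem i)]
    have h := hstrict i
    simp only [mulVec_sub, mulVec_smul, Pi.sub_apply, Pi.smul_apply, smul_eq_mul] at h ⊢
    have := mul_pos (inv_pos.mpr hs) h
    linarith
  exact hlt.not_ge (hmax hmem)

theorem eq_smul_of_pos_eigenvector [Nonempty ι] (hM : ∀ i j, 0 < M i j) {r : ℝ} {x z : ι → ℝ}
    (hx : ∀ i, 0 < x i) (hMx : M *ᵥ x = r • x) (hMz : M *ᵥ z = r • z) :
    ∃ t : ℝ, z = t • x := by
  obtain ⟨k, hk⟩ := Finite.exists_min fun i => z i / x i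
  refine ⟨z k / x k, ?_⟩
  by_contra hcon
  have hnonneg : 0 ≤ z - (z k / x k) • x := fun i => by
    simpa using (le_div_iff₀ (hx i)).mp (hk i)
  have h := mulVec_apply_pos_of_pos hM hnonneg (sub_ne_zero.mpr hcon) k
  have hxk := (hx k).ne'
  simp only [mulVec_sub, mulVec_smul, hMx, hMz, Pi.sub_apply, Pi.smul_apply, smul_eq_mul] at h
  field_simp at h
  linarith

end Perron

/-- A matrix with a positive entry in each position `(i, σ i)`, all other entries nonpositive, and
a positive eigenvector for a positive eigenvalue is nonsingular. -/
theorem det_ne_zero_of_pos_eigenvector {ι : Type*} [Fintype ι] [DecidableEq ι]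
    {C : Matrix ι ι ℝ} {σ : Equiv.Perm ι} (hσ : ∀ i, 0 < C i (σ i))
    (hC : ∀ i j, j ≠ σ i → C i j ≤ 0) {μ : ℝ} (hμ : 0 < μ) {v : ι → ℝ} (hv : ∀ i, 0 < v i)
    (hCv : C *ᵥ v = μ • v) : C.det ≠ 0 := by
  intro hdet
  obtain ⟨w, hw, hCw⟩ := exists_mulVec_eq_zero_iff.mpr hdet
  obtain ⟨a, -⟩ := Function.ne_iff.mp hw
  have : Nonempty ι := ⟨a⟩
  obtain ⟨k, hk⟩ := Finite.exists_max fun i => |w i| / v i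
  set m := |w k| / v k with hm
  have hbound : ∀ i, |w i| ≤ m * v i := fun i => (div_le_iff₀ (hv i)).mp (hk i)
  have hwk : |w k| = m * v k := by rw [hm, div_mul_cancel₀ _ (hv k).ne']
  have hmpos : 0 < m := by
    obtain ⟨b, hb⟩ := Function.ne_iff.mp hw
    exact (div_pos (abs_pos.mpr hb) (hv b)).trans_le (hk b)
  obtain ⟨i, rfl⟩ := σ.surjective k
  have hrow : C i (σ i) * v (σ i) + ∑ j ∈ Finset.univ.erase (σ i), C i j * v j = μ * v i := by
    rw [Finset.add_sum_erase _ (fun j => C i j * v j) (Finset.mem_univ _)]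
    exact congrFun hCv i
  have hker : C i (σ i) * w (σ i) + ∑ j ∈ Finset.univ.erase (σ i), C i j * w j = 0 := by
    rw [Finset.add_sum_erase _ (fun j => C i j * w j) (Finset.mem_univ _)]
    exact congrFun hCw i
  have hsum : |∑ j ∈ Finset.univ.erase (σ i), C i j * w j| ≤
      -(m * ∑ j ∈ Finset.univ.erase (σ i), C i j * v j) := by
    rw [Finset.mul_sum, ← Finset.sum_neg_distrib]
    refine (Finset.abs_sum_le_sum_abs _ _).trans (Finset.sum_le_sum fun j hj => ?_)
    have hj0 := hC i j (Finset.ne_of_mem_erase hj)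
    rw [abs_mul, abs_of_nonpos hj0]
    nlinarith [hbound j]
  have habs := congrArg abs (eq_neg_of_add_eq_zero_left hker)
  rw [abs_neg, abs_mul, abs_of_pos (hσ i), hwk] at habs
  nlinarith [mul_pos hmpos (mul_pos hμ (hv i))]

end Matrix

theorem AlgPositive.exists_pos_eigenvector {n : ℕ} [NeZero n] {B : Matrix (Fin n) (Fin n) ℝ}
    (h : AlgPositive B) : ∃ (μ : ℝ) (v : Fin n → ℝ), (∀ i, 0 < v i) ∧ B *ᵥ v = μ • v := by
  obtain ⟨f, hf⟩ := h
  obtain ⟨r, x, hx, hMx⟩ := exists_pos_eigenvector_of_pos hf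
  have hcomm : Polynomial.aeval B f * B = B * Polynomial.aeval B f :=
    Commute.eq <| by simpa using
      (Commute.all f Polynomial.X).map (Polynomial.aeval (R := ℝ) B)
  obtain ⟨t, ht⟩ := eq_smul_of_pos_eigenvector hf hx hMx (z := B *ᵥ x)
    (by rw [mulVec_mulVec, hcomm, ← mulVec_mulVec, hMx, mulVec_smul])
  exact ⟨t, x, hx, ht⟩

theorem AlgPositive.transpose {n : ℕ} {B : Matrix (Fin n) (Fin n) ℝ} (h : AlgPositive B) :
    AlgPositive Bᵀ := by
  obtain ⟨f, hf⟩ := h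
  refine ⟨f, fun i j => ?_⟩
  have : Polynomial.aeval Bᵀ f = (Polynomial.aeval B f)ᵀ := by
    simp [Polynomial.aeval_eq_sum_range, transpose_sum, transpose_pow]
  rw [this]
  exact hf j i

/-- A sign pattern whose positive entries are those at `(i, σ i)` and whose other off-diagonal
nonzero entries are at `(σ i, i)`. -/
def IsPermPattern {n : ℕ} (A : Matrix (Fin n) (Fin n) SignType) (σ : Equiv.Perm (Fin n)) : Prop :=
  (∀ i, A i (σ i) = 1) ∧ (∀ i j, j ≠ σ i → A i j ≠ 1) ∧
    ∀ i j, i ≠ j → j ≠ σ i → i ≠ σ j → A i j = 0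

theorem IsPermPattern.transpose {n : ℕ} {A : Matrix (Fin n) (Fin n) SignType}
    {σ : Equiv.Perm (Fin n)} (h : IsPermPattern A σ) : IsPermPattern Aᵀ σ⁻¹ := by
  refine ⟨fun i => ?_, fun i j hij => h.2.1 j i ?_, fun i j hij h1 h2 => h.2.2 j i hij.symm ?_ ?_⟩
  · simpa using h.1 (σ⁻¹ i)
  · rintro rfl; simp at hij
  · rintro rfl; simp at h1
  · rintro rfl; simp at h2

theorem IsPermPattern.diag_eq_neg_one {n : ℕ} [NeZero n] {A : Matrix (Fin n) (Fin n) SignType}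
    {σ : Equiv.Perm (Fin n)} (h : IsPermPattern A σ) (hdiag : ∀ i, A i i ≠ 1)
    {B : Matrix (Fin n) (Fin n) ℝ} (hB : InQClass A B) (hdet : B.det = 0) (hap : AlgPositive B)
    {i j : Fin n} (hij : A i j = 1) (hji : A j i = 0) : A j j = -1 := by
  obtain ⟨h1, h2, h3⟩ := h
  obtain ⟨μ, v, hv, hBv⟩ := hap.exists_pos_eigenvector
  have hσpos : ∀ k, 0 < B k (σ k) := fun k => sign_eq_one_iff.mp ((hB k (σ k)).trans (h1 k))
  have hnonpos : ∀ k l, l ≠ σ k → B k l ≤ 0 := fun k l hl => by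
    by_contra! hlt
    exact h2 k l hl ((hB k l).symm.trans (sign_pos hlt))
  by_contra hjj
  have hjj0 : A j j = 0 := by
    rcases SignType.trichotomy (A j j) with h | h | h
    exacts [absurd h hjj, h, absurd h (hdiag j)]
  have hjσ : j = σ i := by
    by_contra hne
    exact h2 i j hne hij
  have hrow : ∀ k, 0 ≤ B j k := fun k => by
    by_cases hk : k = σ j
    · exact hk ▸ (hσpos j).le
    have hzero : A j k = 0 := by
      by_cases hkj : j = k
      · exact hkj ▸ hjj0
      by_cases hki : j = σ k
      · rwa [σ.injective (hki.symm.trans hjσ)]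
      · exact h3 j k hkj hk hki
    exact (sign_eq_zero_iff.mp ((hB j k).trans hzero)).ge
  have hμv : 0 < μ * v j := by
    have : (B *ᵥ v) j = μ * v j := congrFun hBv j
    rw [← this]
    exact Finset.sum_pos' (fun k _ => mul_nonneg (hrow k) (hv k).le)
      ⟨σ j, Finset.mem_univ _, mul_pos (hσpos j) (hv _)⟩
  exact det_ne_zero_of_pos_eigenvector hσpos hnonpos (pos_of_mul_pos_left hμv (hv j).le) hv hBv hdet

theorem CycleForm.exists_isPermPattern {n : ℕ} [NeZero n] {A : Matrix (Fin n) (Fin n) SignType}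
    (hcyc : CycleForm A) (hdiag : ∀ i, A i i ≠ 1)
    (hneg2 : ∀ i j : Fin n, i ≠ j → A i j ≠ 0 → A j i ≠ 0 → A i j * A j i = -1)
    (hplus : PlusNCycle A) : ∃ σ, IsPermPattern A σ := by
  have key : ∀ σ : Equiv.Perm (Fin n), (∀ i, A i (σ i) = 1) →
      (∀ i j, i ≠ j → j ≠ σ i → i ≠ σ j → A i j = 0) → IsPermPattern A σ := by
    refine fun σ h1 h3 => ⟨h1, fun i j hj hij => ?_, h3⟩
    have hne : i ≠ j := by
      rintro rfl
      exact hdiag i hij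
    by_cases hi : i = σ j
    · have hji : A j i = 1 := hi ▸ h1 j
      have := hneg2 i j hne (by simp [hij]) (by simp [hji])
      rw [hij, hji] at this
      exact absurd this (by decide)
    · rw [h3 i j hne hj hi] at hij
      exact absurd hij (by decide)
  rcases hplus with h | h
  · exact ⟨Equiv.addRight 1, key _ h hcyc.1⟩
  · refine ⟨(Equiv.addRight 1).symm, key _ (fun i => ?_) fun i j hij h1 h2 => ?_⟩
    · simpa [sub_eq_add_neg] using h (i - 1)
    · refine hcyc.1 i j hij ?_ ?_
      · rintro rfl; simp at h2
      · rintro rfl; simp at h1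

/-- Cycle-form `A` with nonpositive diagonal, all directed 2-cycles
negative, a directed `n`-cycle in `D(A_+)` but none in `D(A_-)`, and some negative
2-cycle: if `A` is not SNS and requires algebraic positivity, then `a_{ii} = -` and
`a_{jj} = -` whenever `a_{ij} = +` and `a_{ji} = 0` (`i ≠ j`). -/
theorem stmt_11 {n : ℕ} [NeZero n] (hn : 3 ≤ n) (A : Matrix (Fin n) (Fin n) SignType)
    (hcyc : CycleForm A)
    (hdiag : ∀ i : Fin n, A i i ≠ 1)
    (hneg2 : ∀ i j : Fin n, i ≠ j → A i j ≠ 0 → A j i ≠ 0 → A i j * A j i = -1)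
    (hplus : PlusNCycle A) (hminus : ¬ MinusNCycle A)
    (hex : ∃ i j : Fin n, i ≠ j ∧ A i j * A j i = -1)
    (hnsns : ¬ IsSNS A) (hreq : RequiresAP A) :
    ∀ i j : Fin n, i ≠ j → A i j = 1 → A j i = 0 → A i i = -1 ∧ A j j = -1 := by
  intro i j _ hij hji
  obtain ⟨B, hB, hdet⟩ : ∃ B, InQClass A B ∧ B.det = 0 := by
    simpa [IsSNS] using hnsns
  obtain ⟨σ, hσ⟩ := hcyc.exists_isPermPattern hdiag hneg2 hplus
  have hap := hreq B hB
  exact ⟨hσ.transpose.diag_eq_neg_one (B := Bᵀ) hdiag (fun k l => hB l k)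
      ((det_transpose B).trans hdet) hap.transpose (i := j) (j := i) hij hji,
    hσ.diag_eq_neg_one hdiag hB hdet hap hij hji⟩
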